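/- arXiv:1605.07401 — 3 statements merged into one kernel-verified Lean document; each statement's English description precedes it below -/
import Mathlib

section
/- Let R = ℤ_(2)[v₁, v₂, v₂⁻¹], let c : R → R be the ring involution with c(v₁) = −v₁ and c(v₂) = −v₂, and let d : R → R be the ℤ_(2)-linear map d(y) = v₂⁻³·(y − c(y)). Then: (i) d∘d = 0; (ii) ker d equals the fixed subring R^c (the span of the monomials v₁^a v₂^b with a + b even); (iii) im d = 2·R^c; and (iv) the quotient ring ker d / im d is isomorphic to the Laurent polynomial ring 𝔽₂[s, t, t⁻¹] via an isomorphism sending the class of v₁v₂⁻³ to s and the class of v₂² to t. (This is the paper's computation of the E₂-term of the Bockstein spectral sequence for the coefficients: d₁(v₂) = 2v₂⁻² and E₂ = ℤ/2[v̂₁, v₂^{±2}], where v̂₁ = v₁v₂⁻³.) -/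
noncomputable section

open LaurentPolynomial

instance : (Ideal.span {(2 : ℤ)}).IsPrime :=
  (Ideal.span_singleton_prime (by norm_num)).mpr Int.prime_two

/-- `ℤ_(2)`, the localization of `ℤ` at the prime ideal `(2)`. -/
abbrev ZTwoLocal : Type := Localization.AtPrime (Ideal.span {(2 : ℤ)})

/-- The ring `R = ℤ_(2)[v₁, v₂, v₂⁻¹]` (the coefficients of `E(2)`, gradings
forgotten), modeled as Laurent polynomials in `v₂` over polynomials in `v₁`. -/
abbrev E2Coeff : Type := LaurentPolynomial (Polynomial ZTwoLocal)

/-- The element `v₁` (the variable `v₂` is `T 1`, and `v₂⁻¹` is `T (-1)`). -/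
def v₁E2 : E2Coeff := LaurentPolynomial.C Polynomial.X

/-- The fixed subring `R^c` of the involution `c`. -/
def fixedSubring (c : E2Coeff →+* E2Coeff) : Subring E2Coeff :=
  RingHom.eqLocus c (RingHom.id E2Coeff)

/-- Ring homomorphisms out of `k[X][T;T⁻¹]` are determined by their values on the coefficients
and on the two variables. -/
theorem LaurentPolynomial.ringHom_ext_polynomial {k S : Type*} [CommRing k] [CommRing S]
    {f g : LaurentPolynomial (Polynomial k) →+* S}
    (hC : ∀ a, f (C (Polynomial.C a)) = g (C (Polynomial.C a)))
    (hX : f (C Polynomial.X) = g (C Polynomial.X)) (hT : f (T 1) = g (T 1)) : f = g := by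
  refine IsLocalization.ringHom_ext
    (Submonoid.powers (Polynomial.X : Polynomial (Polynomial k))) ?_
  refine Polynomial.ringHom_ext (fun p => ?_) ?_
  · have h : f.comp C = g.comp C := Polynomial.ringHom_ext hC hX
    simpa using DFunLike.congr_fun h p
  · simpa using hT

section MonomialSubring

variable (k : Type*) [CommRing k]

/-- The substitution `X ↦ X * T m`, `T ↦ T` of `k[X][T;T⁻¹]`. -/
def twistHom (m : ℤ) : LaurentPolynomial (Polynomial k) →+* LaurentPolynomial (Polynomial k) :=
  eval₂ (Polynomial.eval₂RingHom (C.comp Polynomial.C) (C Polynomial.X * T m))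
    (isUnit_T 1).unit

variable {k}

@[simp]
theorem twistHom_C_C (m : ℤ) (a : k) :
    twistHom k m (C (Polynomial.C a)) = C (Polynomial.C a) := by
  simp [twistHom]

@[simp]
theorem twistHom_C_X (m : ℤ) : twistHom k m (C Polynomial.X) = C Polynomial.X * T m := by
  simp [twistHom]

@[simp]
theorem twistHom_T (m n : ℤ) : twistHom k m (T n) = T n := by
  have h1 : twistHom k m (T 1) = T 1 := by simp [twistHom]
  have hnat (j : ℕ) : twistHom k m (T j) = T j := by
    rw [← mul_one (j : ℤ), ← T_pow, map_pow, h1]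
  obtain ⟨j, rfl | rfl⟩ := n.eq_nat_or_neg
  · exact hnat j
  · refine (isUnit_T (j : ℤ)).mul_left_cancel ?_
    have h : (T j * T (-j) : LaurentPolynomial (Polynomial k)) = 1 := by
      rw [← T_add, add_neg_cancel, T_zero]
    have h' := congrArg (twistHom k m) h
    rwa [map_mul, hnat, map_one, ← h] at h'

theorem twistHom_neg_twistHom (m : ℤ) (f : LaurentPolynomial (Polynomial k)) :
    twistHom k (-m) (twistHom k m f) = f := by
  have h : (twistHom k (-m)).comp (twistHom k m) = RingHom.id _ := by
    refine ringHom_ext_polynomial (fun a => by simp) ?_ (by simp)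
    rw [RingHom.comp_apply, twistHom_C_X, map_mul, twistHom_C_X, twistHom_T, mul_assoc, ← T_add,
      neg_add_cancel, T_zero, mul_one, RingHom.id_apply]
  exact DFunLike.congr_fun h f

variable (k) in
/-- The substitution `X ↦ X * T (-3)`, `T ↦ T 2` of `k[X][T;T⁻¹]`. -/
def evenHom : LaurentPolynomial (Polynomial k) →+* LaurentPolynomial (Polynomial k) :=
  (twistHom k (-3)).comp
    (AddMonoidAlgebra.mapDomainRingHom (Polynomial k) (AddMonoidHom.mulLeft (2 : ℤ)))

theorem mapDomainRingHom_C (f : ℤ →+ ℤ) (p : Polynomial k) :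
    AddMonoidAlgebra.mapDomainRingHom (Polynomial k) f (C p) = C p := by
  rw [← single_eq_C]
  exact AddMonoidAlgebra.mapDomain_single.trans (by simp)

theorem mapDomainRingHom_T (f : ℤ →+ ℤ) (n : ℤ) :
    AddMonoidAlgebra.mapDomainRingHom (Polynomial k) f (T n) = T (f n) :=
  AddMonoidAlgebra.mapDomain_single

@[simp]
theorem evenHom_C_C (a : k) : evenHom k (C (Polynomial.C a)) = C (Polynomial.C a) := by
  rw [evenHom, RingHom.comp_apply, mapDomainRingHom_C, twistHom_C_C]

@[simp]
theorem evenHom_C_X : evenHom k (C Polynomial.X) = C Polynomial.X * T (-3) := by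
  rw [evenHom, RingHom.comp_apply, mapDomainRingHom_C, twistHom_C_X]

@[simp]
theorem evenHom_T (n : ℤ) : evenHom k (T n) = T (2 * n) := by
  rw [evenHom, RingHom.comp_apply, mapDomainRingHom_T, twistHom_T, AddMonoidHom.coe_mulLeft]

theorem evenHom_injective : Function.Injective (evenHom k) := by
  have h2 : Function.Injective (AddMonoidHom.mulLeft (2 : ℤ)) := mul_right_injective₀ two_ne_zero
  rw [evenHom, RingHom.coe_comp]
  exact (Function.LeftInverse.injective (twistHom_neg_twistHom (-3))).comp
    (AddMonoidAlgebra.mapDomain_injective h2)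

theorem exists_eq_evenHom_add (y : LaurentPolynomial (Polynomial k)) :
    ∃ a b, y = evenHom k a + T 1 * evenHom k b := by
  induction y using LaurentPolynomial.induction_on' with
  | add p q hp hq =>
    obtain ⟨a, b, rfl⟩ := hp
    obtain ⟨a', b', rfl⟩ := hq
    exact ⟨a + a', b + b', by simp only [map_add]; ring⟩
  | C_mul_T n p =>
    induction p using Polynomial.induction_on' with
    | add p q hp hq =>
      obtain ⟨a, b, h⟩ := hp
      obtain ⟨a', b', h'⟩ := hq
      exact ⟨a + a', b + b', by simp only [map_add, add_mul, h, h']; ring⟩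
    | monomial j r =>
      have key (m : ℤ) : evenHom k (C (Polynomial.monomial j r) * T m) =
          C (Polynomial.monomial j r) * T (2 * m - 3 * j) := by
        rw [← Polynomial.C_mul_X_pow_eq_monomial]
        simp only [map_mul, map_pow, evenHom_C_C, evenHom_C_X, evenHom_T, mul_pow, T_pow]
        rw [mul_assoc, mul_assoc, ← T_add, ← mul_assoc]
        congr 2
        ring
      obtain ⟨m, hm | hm⟩ := (n + 3 * j).even_or_odd'
      · refine ⟨C (Polynomial.monomial j r) * T m, 0, ?_⟩
        rw [key, map_zero, mul_zero, add_zero, ← hm]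
        simp
      · refine ⟨0, C (Polynomial.monomial j r) * T m, ?_⟩
        rw [key, map_zero, zero_add, mul_left_comm, ← T_add]
        congr 2
        linarith

end MonomialSubring

theorem LaurentPolynomial.C_dvd_of_forall_dvd_coeff {R : Type*} [CommRing R] (r : R)
    (f : LaurentPolynomial R) (h : ∀ n, r ∣ f.coeff n) : C r ∣ f := by
  rw [← AddMonoidAlgebra.sum_coeff_single f]
  refine Finset.dvd_sum fun n _ => ?_
  obtain ⟨g, hg⟩ := h n
  exact ⟨C g * T n, by rw [hg, single_eq_C_mul_T, map_mul, mul_assoc]⟩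

section Reduction

variable {k F : Type*} [CommRing k] [CommRing F] (ρ : k →+* F)

/-- The ring homomorphism `k[X][T;T⁻¹] → F[X][T;T⁻¹]` applying `ρ` to the coefficients. -/
def reductionHom : LaurentPolynomial (Polynomial k) →+* LaurentPolynomial (Polynomial F) :=
  AddMonoidAlgebra.mapRingHom ℤ (Polynomial.mapRingHom ρ)

variable {ρ}

@[simp]
theorem reductionHom_C (p : Polynomial k) : reductionHom ρ (C p) = C (p.map ρ) :=
  AddMonoidAlgebra.mapRingHom_single ..

@[simp]
theorem reductionHom_T (n : ℤ) : reductionHom ρ (T n) = T n :=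
  (AddMonoidAlgebra.mapRingHom_single ..).trans (by rw [map_one]; rfl)

theorem reductionHom_surjective (hρ : Function.Surjective ρ) :
    Function.Surjective (reductionHom ρ) :=
  AddMonoidAlgebra.map_surjective _ (Polynomial.map_surjective _ hρ)

theorem ker_reductionHom (hker : RingHom.ker ρ = Ideal.span {2}) :
    RingHom.ker (reductionHom ρ) = Ideal.span {2} := by
  ext f
  rw [RingHom.mem_ker, Ideal.mem_span_singleton]
  constructor
  · intro hf
    rw [← map_ofNat C 2]
    refine LaurentPolynomial.C_dvd_of_forall_dvd_coeff _ _ fun n => ?_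
    rw [← map_ofNat Polynomial.C 2, Polynomial.C_dvd_iff_dvd_coeff]
    intro i
    have h : (f.coeff n).map ρ = 0 := congrArg (fun g => g.coeff n) hf
    have hi : ρ ((f.coeff n).coeff i) = 0 := by
      simpa using congrArg (fun p => p.coeff i) h
    rwa [← RingHom.mem_ker, hker, Ideal.mem_span_singleton] at hi
  · rintro ⟨g, rfl⟩
    have h2 : ρ 2 = 0 := by
      rw [← RingHom.mem_ker, hker]
      exact Ideal.mem_span_singleton_self 2
    rw [← map_ofNat C 2, ← map_ofNat Polynomial.C 2, map_mul, reductionHom_C, Polynomial.map_C,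
      h2]
    simp

theorem two_mul_eq_zero_of_coeff (h2 : ∀ x : k, 2 * x = 0 → x = 0)
    {y : LaurentPolynomial (Polynomial k)} (h : 2 * y = 0) : y = 0 := by
  ext n i
  have hn := congrArg (fun g => (g.coeff n).coeff i) h
  rw [two_mul] at hn
  exact h2 _ (by rw [two_mul]; simpa using hn)

end Reduction

section Conjugation

variable {k : Type*} [CommRing k]
  {c : LaurentPolynomial (Polynomial k) →+* LaurentPolynomial (Polynomial k)}

theorem conj_T_two (hT : c (T 1) = -(T 1 : LaurentPolynomial (Polynomial k))) : c (T 2) = T 2 := by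
  have h : (T 2 : LaurentPolynomial (Polynomial k)) = T 1 ^ 2 := by rw [T_pow]; rfl
  rw [h, map_pow, hT]
  ring

theorem conj_T_neg_three (hT : c (T 1) = -(T 1 : LaurentPolynomial (Polynomial k))) :
    c (T (-3)) = -T (-3) := by
  have h3 : c (T 3) = -T 3 := by
    have h : (T 3 : LaurentPolynomial (Polynomial k)) = T 1 ^ 3 := by rw [T_pow]; rfl
    rw [h, map_pow, hT]
    ring
  have h1 : (T 3 * T (-3) : LaurentPolynomial (Polynomial k)) = 1 := by
    rw [← T_add, add_neg_cancel, T_zero]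
  have h := congrArg c h1
  rw [map_mul, h3, map_one] at h
  linear_combination -T (-3) * h - c (T (-3)) * h1

theorem conj_evenHom (hC : ∀ a, c (C (Polynomial.C a)) = C (Polynomial.C a))
    (hX : c (C Polynomial.X) = -(C Polynomial.X : LaurentPolynomial (Polynomial k)))
    (hT : c (T 1) = -T 1)
    (a : LaurentPolynomial (Polynomial k)) : c (evenHom k a) = evenHom k a := by
  have h : c.comp (evenHom k) = evenHom k :=
    ringHom_ext_polynomial (fun r => by simp [hC])
      (by rw [RingHom.comp_apply, evenHom_C_X, map_mul, hX, conj_T_neg_three hT]; ring)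
      (by simp [conj_T_two hT])
  exact DFunLike.congr_fun h a

theorem exists_evenHom_eq_of_conj_eq (hC : ∀ a, c (C (Polynomial.C a)) = C (Polynomial.C a))
    (hX : c (C Polynomial.X) = -(C Polynomial.X : LaurentPolynomial (Polynomial k)))
    (hT : c (T 1) = -T 1)
    (h2 : ∀ x : k, 2 * x = 0 → x = 0) {y : LaurentPolynomial (Polynomial k)} (hy : c y = y) :
    ∃ a, evenHom k a = y := by
  obtain ⟨a, b, rfl⟩ := exists_eq_evenHom_add y
  refine ⟨a, ?_⟩
  rw [map_add, map_mul, hT, conj_evenHom hC hX hT, conj_evenHom hC hX hT] at hy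
  have h0 : T 1 * evenHom k b = 0 :=
    two_mul_eq_zero_of_coeff h2 (by linear_combination -hy)
  rw [h0, add_zero]

/-- The subring fixed by `c` is a Laurent polynomial ring on `X * T (-3)` and `T 2`. -/
def evenEquivFixed (hC : ∀ a, c (C (Polynomial.C a)) = C (Polynomial.C a))
    (hX : c (C Polynomial.X) = -(C Polynomial.X : LaurentPolynomial (Polynomial k)))
    (hT : c (T 1) = -T 1)
    (h2 : ∀ x : k, 2 * x = 0 → x = 0) :
    LaurentPolynomial (Polynomial k) ≃+* RingHom.eqLocus c (RingHom.id _) :=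
  RingEquiv.ofBijective ((evenHom k).codRestrict _ (conj_evenHom hC hX hT))
    ⟨fun _ _ h => evenHom_injective (congrArg Subtype.val h), fun y => by
      obtain ⟨a, ha⟩ := exists_evenHom_eq_of_conj_eq hC hX hT h2 y.2
      exact ⟨a, Subtype.ext ha⟩⟩

theorem exists_fixed_quotient_equiv {F : Type*} [CommRing F] {ρ : k →+* F}
    (hC : ∀ a, c (C (Polynomial.C a)) = C (Polynomial.C a))
    (hX : c (C Polynomial.X) = -(C Polynomial.X : LaurentPolynomial (Polynomial k)))
    (hT : c (T 1) = -T 1)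
    (h2 : ∀ x : k, 2 * x = 0 → x = 0) (hρ : Function.Surjective ρ)
    (hker : RingHom.ker ρ = Ideal.span {2}) :
    ∃ e : (RingHom.eqLocus c (RingHom.id _) ⧸
          (Ideal.span {(2 : RingHom.eqLocus c (RingHom.id _))})) ≃+*
        LaurentPolynomial (Polynomial F),
      (∀ x : RingHom.eqLocus c (RingHom.id _),
          (x : LaurentPolynomial (Polynomial k)) = C Polynomial.X * T (-3) →
          e (Ideal.Quotient.mk _ x) = C Polynomial.X) ∧
      (∀ x : RingHom.eqLocus c (RingHom.id _),
          (x : LaurentPolynomial (Polynomial k)) = T 2 →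
          e (Ideal.Quotient.mk _ x) = T 1) := by
  let φ := evenEquivFixed hC hX hT h2
  let e := (Ideal.quotientEquiv (Ideal.span {2}) (Ideal.span {2}) φ.symm (by
      rw [Ideal.map_span, Set.image_singleton, RingHom.coe_coe, map_ofNat])).trans <|
    (Ideal.quotEquivOfEq (ker_reductionHom hker).symm).trans <|
      RingHom.quotientKerEquivOfSurjective (reductionHom_surjective hρ)
  have he (x : RingHom.eqLocus c (RingHom.id _)) (a : LaurentPolynomial (Polynomial k))
      (h : (x : LaurentPolynomial (Polynomial k)) = evenHom k a) :
      e (Ideal.Quotient.mk _ x) = reductionHom ρ a := by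
    rw [show a = φ.symm x from ((RingEquiv.symm_apply_eq _).mpr (Subtype.ext h)).symm]
    rfl
  refine ⟨e, fun x hx => ?_, fun x hx => ?_⟩
  · rw [he x (C Polynomial.X) (by simpa using hx)]
    simp
  · rw [he x (T 1) (by simpa using hx)]
    simp

theorem conj_bockstein_eq (hinv : ∀ y, c (c y) = y) (hT : c (T 1) = -T 1)
    (y : LaurentPolynomial (Polynomial k)) : c (T (-3) * (y - c y)) = T (-3) * (y - c y) := by
  rw [map_mul, map_sub, hinv, conj_T_neg_three hT]
  ring

theorem bockstein_eq_zero_iff (y : LaurentPolynomial (Polynomial k)) :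
    T (-3) * (y - c y) = 0 ↔ c y = y := by
  rw [(isUnit_T (-3)).mul_right_eq_zero, sub_eq_zero, eq_comm]

theorem exists_bockstein_eq_iff (hC : ∀ a, c (C (Polynomial.C a)) = C (Polynomial.C a))
    (hX : c (C Polynomial.X) = -(C Polynomial.X : LaurentPolynomial (Polynomial k)))
    (hT : c (T 1) = -T 1)
    (y : LaurentPolynomial (Polynomial k)) :
    (∃ x, T (-3) * (x - c x) = y) ↔ ∃ z, c z = z ∧ y = 2 * z := by
  have hc3 := conj_T_neg_three hT
  constructor
  · rintro ⟨x, rfl⟩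
    obtain ⟨a, b, rfl⟩ := exists_eq_evenHom_add x
    have ha := conj_evenHom hC hX hT a
    have hb := conj_evenHom hC hX hT b
    refine ⟨T (-3) * (T 1 * evenHom k b), ?_, ?_⟩
    · rw [map_mul, map_mul, hc3, hT, hb]
      ring
    · rw [map_add, map_mul, hT, ha, hb]
      ring
  · rintro ⟨z, hz, rfl⟩
    have h1 : (T 3 * T (-3) : LaurentPolynomial (Polynomial k)) = 1 := by
      rw [← T_add, add_neg_cancel, T_zero]
    have h := congrArg c h1
    rw [map_mul, hc3, map_one] at h
    refine ⟨T 3 * z, ?_⟩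
    rw [map_mul, hz]
    linear_combination z * h1 + z * h

end Conjugation

section TwoLocal

/-- The residue homomorphism `ℤ_(2) → 𝔽₂`. -/
def residueHom : ZTwoLocal →+* ZMod 2 :=
  IsLocalization.lift (M := (Ideal.span {(2 : ℤ)}).primeCompl) (g := Int.castRingHom (ZMod 2)) <| by
    intro y
    refine IsUnit.mk0 _ fun h => y.2 ?_
    exact Ideal.mem_span_singleton.mpr ((ZMod.intCast_zmod_eq_zero_iff_dvd _ 2).mp h)

theorem ker_residueHom : RingHom.ker residueHom = Ideal.span {2} := by
  ext x
  refine RingHom.mem_ker.trans (Iff.trans ⟨fun hx => ?_, ?_⟩ Ideal.mem_span_singleton.symm)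
  · obtain ⟨a, s, rfl⟩ := IsLocalization.exists_mk'_eq (Ideal.span {(2 : ℤ)}).primeCompl x
    rw [residueHom, IsLocalization.lift_mk'_spec, mul_zero] at hx
    obtain ⟨b, rfl⟩ := (ZMod.intCast_zmod_eq_zero_iff_dvd a 2).mp hx
    refine ⟨IsLocalization.mk' _ b s, ?_⟩
    rw [Nat.cast_ofNat, ← IsLocalization.mul_mk'_eq_mk'_of_mul]
    simp
  · rintro ⟨y, rfl⟩
    rw [map_mul, map_ofNat, show (2 : ZMod 2) = 0 from rfl, zero_mul]

theorem ZTwoLocal.eq_zero_of_two_mul_eq_zero (x : ZTwoLocal) (h : 2 * x = 0) : x = 0 := by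
  have h2 : (2 : ZTwoLocal) ≠ 0 := by
    have := (IsLocalization.injective ZTwoLocal
      (Ideal.span {(2 : ℤ)}).primeCompl_le_nonZeroDivisors).ne (two_ne_zero (α := ℤ))
    simpa using this
  exact (mul_eq_zero.mp h).resolve_left h2

theorem ringHom_C_C_eq (c : E2Coeff →+* E2Coeff) (a : ZTwoLocal) :
    c (C (Polynomial.C a)) = C (Polynomial.C a) := by
  have h : c.comp (C.comp Polynomial.C) = C.comp Polynomial.C :=
    IsLocalization.ringHom_ext (Ideal.span {(2 : ℤ)}).primeCompl (RingHom.ext_int _ _)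
  exact DFunLike.congr_fun h a

end TwoLocal

set_option synthInstance.maxHeartbeats 1000000 in
set_option maxHeartbeats 2000000 in
/-- Let `R = ℤ_(2)[v₁, v₂, v₂⁻¹]`, let `c` be the ring involution
with `c(v₁) = −v₁` and `c(v₂) = −v₂` (here `v₂ = T 1`), and let `d` be the
`ℤ_(2)`-linear map `d(y) = v₂⁻³·(y − c(y))`.  Then: (i) `d∘d = 0`; (ii) `ker d`
equals the fixed subring `R^c`; (iii) `im d = 2·R^c`; and (iv) the quotient ring
`ker d / im d` is isomorphic to `𝔽₂[s, t, t⁻¹]` via an isomorphism sending the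
class of `v₁v₂⁻³` to `s` and the class of `v₂²` to `t`. -/
theorem bockstein_d1_coefficients
    (c : E2Coeff →+* E2Coeff) (hinv : ∀ y, c (c y) = y)
    (hcv₁ : c v₁E2 = -v₁E2) (hcv₂ : c (T 1) = -(T 1 : E2Coeff)) :
    let d : E2Coeff → E2Coeff := fun y => T (-3) * (y - c y)
    (∀ y, d (d y) = 0) ∧
    (∀ y, d y = 0 ↔ c y = y) ∧
    (∀ y, (∃ x, d x = y) ↔ ∃ z, c z = z ∧ y = 2 * z) ∧
    (∃ e : (fixedSubring c ⧸ (Ideal.span {(2 : fixedSubring c)})) ≃+*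
          LaurentPolynomial (Polynomial (ZMod 2)),
      (∀ x : fixedSubring c,
          (x : E2Coeff) = v₁E2 * T (-3) →
          e (Ideal.Quotient.mk _ x) = LaurentPolynomial.C Polynomial.X) ∧
      (∀ x : fixedSubring c,
          (x : E2Coeff) = T 2 →
          e (Ideal.Quotient.mk _ x) = T 1)) := by
  have hC := ringHom_C_C_eq c
  exact ⟨fun y => (bockstein_eq_zero_iff _).mpr (conj_bockstein_eq hinv hcv₂ y),
    bockstein_eq_zero_iff, exists_bockstein_eq_iff hC hcv₁ hcv₂,
    exists_fixed_quotient_equiv hC hcv₁ hcv₂ ZTwoLocal.eq_zero_of_two_mul_eq_zero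
      (ZMod.ringHom_surjective residueHom) ker_residueHom⟩
end
end

section
/- Let A = 𝔽₂[s][t, t⁻¹] and let B = 𝔽₂[s][t², t⁻²] ⊆ A, so that A is a free B-module with basis {1, t}. Let δ : A → A be the unique B-linear map with δ(1) = 0 and δ(t) = s·t⁻². Then δ∘δ = 0, ker δ = B, im δ = s·B, and the quotient ring ker δ / im δ is isomorphic to the Laurent polynomial ring 𝔽₂[w, w⁻¹] via the class of t² ↦ w. (This is the paper's d₃-stage computation in the Bockstein spectral sequence for the coefficients: with s = v̂₁ and t = v₂², the differential d₃(v₂²) = v̂₁v₂⁻⁴ has homology ℤ/2[v₂^{±4}].) -/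
noncomputable section

open LaurentPolynomial

/-- The ring `A = 𝔽₂[s][t, t⁻¹]` (with `s = C X` and `t = T 1`), modeling the page
`ℤ/2[v̂₁, v₂^{±2}]` of the Bockstein spectral sequence for the coefficients. -/
abbrev APage : Type := LaurentPolynomial (Polynomial (ZMod 2))

/-- The subring `B = 𝔽₂[s][t², t⁻²] ⊆ A`. -/
def BPage : Subring APage :=
  Subring.closure {LaurentPolynomial.C Polynomial.X, T 2, T (-2)}

theorem C_mem_BPage (p : Polynomial (ZMod 2)) : (LaurentPolynomial.C p : APage) ∈ BPage := by
  have hX : (LaurentPolynomial.C Polynomial.X : APage) ∈ BPage :=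
    Subring.subset_closure (by simp)
  induction p using Polynomial.induction_on' with
  | add p q hp hq => simpa only [map_add] using add_mem hp hq
  | monomial n a =>
    rw [← Polynomial.C_mul_X_pow_eq_monomial, map_mul, map_pow]
    refine mul_mem ?_ (pow_mem hX n)
    obtain rfl | rfl : a = 0 ∨ a = 1 := by decide +revert
    · simp
    · simp

theorem T_two_mul_mem_BPage (n : ℤ) : (T (2 * n) : APage) ∈ BPage := by
  obtain ⟨k, rfl | rfl⟩ := n.eq_nat_or_neg
  · rw [mul_comm, ← T_pow]
    exact pow_mem (Subring.subset_closure (by simp)) k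
  · rw [show (2 * -(k : ℤ)) = k * (-2) by ring, ← T_pow]
    exact pow_mem (Subring.subset_closure (by simp)) k

/-- Every element of `A` is of the form `b₁ + b₂ t` with `b₁, b₂ ∈ B`. -/
theorem exists_eq_add_mul_T_one (y : APage) :
    ∃ b₁ ∈ BPage, ∃ b₂ ∈ BPage, y = b₁ + b₂ * T 1 := by
  induction y using LaurentPolynomial.induction_on' with
  | add p q hp hq =>
    obtain ⟨a₁, ha₁, a₂, ha₂, rfl⟩ := hp
    obtain ⟨b₁, hb₁, b₂, hb₂, rfl⟩ := hq
    exact ⟨a₁ + b₁, add_mem ha₁ hb₁, a₂ + b₂, add_mem ha₂ hb₂, by ring⟩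
  | C_mul_T n a =>
    obtain ⟨k, rfl | rfl⟩ := n.even_or_odd'
    · exact ⟨_, mul_mem (C_mem_BPage a) (T_two_mul_mem_BPage k), 0, zero_mem _, by simp⟩
    · exact ⟨0, zero_mem _, _, mul_mem (C_mem_BPage a) (T_two_mul_mem_BPage k), by
        rw [zero_add, T_add, mul_assoc]⟩

theorem eq_zero_of_mul_C_X_mul_T {R : Type*} [CommSemiring R] {f : (Polynomial R)[T;T⁻¹]} {n : ℤ}
    (h : f * (LaurentPolynomial.C Polynomial.X * T n) = 0) : f = 0 := by
  rw [← mul_assoc, (isUnit_T n).mul_left_eq_zero, mul_comm, ← smul_eq_C_mul] at h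
  ext1 k
  have hk : Polynomial.X * f.coeff k = 0 := congrArg (fun g => g.coeff k) h
  exact Polynomial.isRegular_X.left (hk.trans (mul_zero _).symm)

/-- The substitution `t ↦ t²` on Laurent polynomials. -/
def expandTwo (R : Type*) [Semiring R] : R[T;T⁻¹] →+* R[T;T⁻¹] :=
  AddMonoidAlgebra.mapDomainRingHom R (AddMonoidHom.mulLeft (2 : ℤ))

theorem expandTwo_injective (R : Type*) [Semiring R] : Function.Injective (expandTwo R) :=
  AddMonoidAlgebra.mapDomain_injective fun a b h => by
    simpa using h

theorem expandTwo_C_mul_T {R : Type*} [Semiring R] (r : R) (n : ℤ) :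
    expandTwo R (LaurentPolynomial.C r * T n) = LaurentPolynomial.C r * T (2 * n) := by
  rw [← single_eq_C_mul_T, ← single_eq_C_mul_T]
  exact AddMonoidAlgebra.mapDomain_single

theorem expandTwo_C {R : Type*} [Semiring R] (r : R) :
    expandTwo R (LaurentPolynomial.C r) = LaurentPolynomial.C r := by
  simpa using expandTwo_C_mul_T r 0

theorem expandTwo_T {R : Type*} [Semiring R] (n : ℤ) :
    expandTwo R (T n) = T (2 * n) := by
  simpa using expandTwo_C_mul_T (1 : R) n

theorem range_expandTwo : (expandTwo (Polynomial (ZMod 2))).range = BPage := by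
  apply le_antisymm
  · rintro _ ⟨f, rfl⟩
    induction f using LaurentPolynomial.induction_on' with
    | add p q hp hq => simpa only [map_add] using add_mem hp hq
    | C_mul_T n a =>
      rw [expandTwo_C_mul_T]
      exact mul_mem (C_mem_BPage a) (T_two_mul_mem_BPage n)
  · refine Subring.closure_le.2 ?_
    rintro _ (rfl | rfl | rfl)
    · exact ⟨_, expandTwo_C _⟩
    · exact ⟨T 1, expandTwo_T 1⟩
    · exact ⟨T (-1), expandTwo_T (-1)⟩

/-- The isomorphism `𝔽₂[s][t, t⁻¹] ≃ B` given by `t ↦ t²`. -/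
def equivBPage : APage ≃+* BPage :=
  (RingEquiv.ofBijective (expandTwo (Polynomial (ZMod 2))).rangeRestrict
    ⟨fun _ _ h => expandTwo_injective _ (congrArg Subtype.val h),
      RingHom.rangeRestrict_surjective _⟩).trans (RingEquiv.subringCongr range_expandTwo)

/-- The reduction `s ↦ 0` on Laurent polynomials over a polynomial ring. -/
def evalZeroCoeff (R : Type*) [CommSemiring R] : (Polynomial R)[T;T⁻¹] →+* R[T;T⁻¹] :=
  AddMonoidAlgebra.mapRingHom ℤ Polynomial.constantCoeff

theorem evalZeroCoeff_C_mul_T {R : Type*} [CommSemiring R] (p : Polynomial R) (n : ℤ) :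
    evalZeroCoeff R (LaurentPolynomial.C p * T n) = LaurentPolynomial.C (p.coeff 0) * T n := by
  rw [← single_eq_C_mul_T, ← single_eq_C_mul_T]
  exact AddMonoidAlgebra.mapRingHom_single ..

theorem evalZeroCoeff_surjective (R : Type*) [CommSemiring R] :
    Function.Surjective (evalZeroCoeff R) :=
  AddMonoidAlgebra.map_surjective _ fun r => ⟨Polynomial.C r, by simp⟩

theorem exists_eq_map_C_evalZeroCoeff_add {R : Type*} [CommSemiring R]
    (f : (Polynomial R)[T;T⁻¹]) :
    ∃ g, f = AddMonoidAlgebra.mapRingHom ℤ Polynomial.C (evalZeroCoeff R f) +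
      LaurentPolynomial.C Polynomial.X * g := by
  induction f using LaurentPolynomial.induction_on' with
  | add p q hp hq =>
    obtain ⟨g, hg⟩ := hp
    obtain ⟨h, hh⟩ := hq
    refine ⟨g + h, ?_⟩
    nth_rewrite 1 [hg, hh]
    simp only [map_add, mul_add]
    abel
  | C_mul_T n a =>
    refine ⟨LaurentPolynomial.C a.divX * T n, ?_⟩
    rw [evalZeroCoeff_C_mul_T, ← single_eq_C_mul_T (a.coeff 0),
      AddMonoidAlgebra.mapRingHom_single, single_eq_C_mul_T, ← mul_assoc, ← map_mul, ← add_mul,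
      ← map_add, add_comm, Polynomial.X_mul_divX_add]

theorem ker_evalZeroCoeff (R : Type*) [CommRing R] :
    RingHom.ker (evalZeroCoeff R) = Ideal.span {LaurentPolynomial.C Polynomial.X} := by
  ext f
  rw [RingHom.mem_ker, Ideal.mem_span_singleton]
  constructor
  · intro hf
    obtain ⟨g, hg⟩ := exists_eq_map_C_evalZeroCoeff_add f
    exact ⟨g, by simpa [hf] using hg⟩
  · rintro ⟨g, rfl⟩
    have hX := evalZeroCoeff_C_mul_T (Polynomial.X : Polynomial R) 0
    simp only [T_zero, mul_one, Polynomial.coeff_X_zero, map_zero] at hX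
    rw [map_mul, hX, zero_mul]

/-- Let `A = 𝔽₂[s][t,t⁻¹]` and `B = 𝔽₂[s][t²,t⁻²] ⊆ A`, so that
`A` is a free `B`-module with basis `{1, t}`, and let `δ : A → A` be the unique
`B`-linear map with `δ(1) = 0` and `δ(t) = s·t⁻²` (so `δ(b₁ + b₂t) = b₂st⁻²` for
`b₁, b₂ ∈ B`).  Then `δ∘δ = 0`, `ker δ = B`, `im δ = s·B`, and the quotient ring
`ker δ / im δ` is isomorphic to `𝔽₂[w, w⁻¹]` via the class of `t² ↦ w`. -/
theorem bockstein_d3_coefficients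
    (δ : APage → APage)
    (hδ : ∀ b₁ b₂ : APage, b₁ ∈ BPage → b₂ ∈ BPage →
      δ (b₁ + b₂ * T 1) = b₂ * (LaurentPolynomial.C Polynomial.X * T (-2))) :
    (∀ y, δ (δ y) = 0) ∧
    (∀ y, δ y = 0 ↔ y ∈ BPage) ∧
    (∀ y, (∃ x, δ x = y) ↔ ∃ b ∈ BPage, y = LaurentPolynomial.C Polynomial.X * b) ∧
    (∃ s' : BPage, (s' : APage) = LaurentPolynomial.C Polynomial.X ∧
      ∃ e : (BPage ⧸ Ideal.span {s'}) ≃+* LaurentPolynomial (ZMod 2),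
        ∀ u : BPage, (u : APage) = T 2 → e (Ideal.Quotient.mk _ u) = T 1) := by
  have hT₂ : (T 2 : APage) ∈ BPage := Subring.subset_closure (by simp)
  have hT₂' : (T (-2) : APage) ∈ BPage := Subring.subset_closure (by simp)
  have hker (b : APage) (hb : b ∈ BPage) : δ b = 0 := by
    simpa using hδ b 0 hb (zero_mem _)
  refine ⟨fun y => ?_, fun y => ⟨fun hy => ?_, hker y⟩, fun y => ⟨?_, ?_⟩, ?_⟩
  · obtain ⟨b₁, hb₁, b₂, hb₂, rfl⟩ := exists_eq_add_mul_T_one y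
    rw [hδ b₁ b₂ hb₁ hb₂]
    exact hker _ (mul_mem hb₂ (mul_mem (C_mem_BPage _) hT₂'))
  · obtain ⟨b₁, hb₁, b₂, hb₂, rfl⟩ := exists_eq_add_mul_T_one y
    rw [hδ b₁ b₂ hb₁ hb₂] at hy
    rwa [eq_zero_of_mul_C_X_mul_T hy, zero_mul, add_zero]
  · rintro ⟨x, rfl⟩
    obtain ⟨b₁, hb₁, b₂, hb₂, rfl⟩ := exists_eq_add_mul_T_one x
    exact ⟨b₂ * T (-2), mul_mem hb₂ hT₂', by rw [hδ b₁ b₂ hb₁ hb₂]; ring⟩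
  · rintro ⟨b, hb, rfl⟩
    refine ⟨0 + b * T 2 * T 1, ?_⟩
    rw [hδ 0 (b * T 2) (zero_mem _) (mul_mem hb hT₂), mul_left_comm, mul_T_assoc]
    simp
  · refine ⟨equivBPage (LaurentPolynomial.C Polynomial.X), expandTwo_C _,
      (Ideal.quotientEquiv _ _ equivBPage.symm ?_).trans
        (RingHom.quotientKerEquivOfSurjective (evalZeroCoeff_surjective (ZMod 2))), fun u hu => ?_⟩
    · rw [ker_evalZeroCoeff, Ideal.map_span]
      simp
    · obtain rfl : equivBPage (T 1) = u := Subtype.ext ((expandTwo_T 1).trans hu.symm)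
      have hT := evalZeroCoeff_C_mul_T (1 : Polynomial (ZMod 2)) 1
      simp only [map_one, one_mul, Polynomial.coeff_one_zero] at hT
      simpa using hT
end
end

section
/- Let R = ℤ_(2)[v₁, v₂, v₂⁻¹, u] (polynomial in v₁ and u, Laurent in v₂), let c : R → R be the ring involution determined by c(v₁) = −v₁, c(v₂) = −v₂, c(u) = −u, let d(y) = v₂⁻³·(y − c(y)), and let I = (u) be the ideal generated by u. Then d(I) ⊆ I, d∘d = 0 on I, and the homology ker(d|_I)/im(d|_I) is a free module over the ring 𝔽₂[s, t, t⁻¹, P] on the classes of v₂u and u², where s, t, P act as the classes of v₁v₂⁻³, v₂², and u² respectively. (This is the paper's computation of the first associated-graded differential d_{1,1} for the reduced Bockstein spectral sequence of CP^∞: after d_{1,1}, all that is left is ℤ/2[v̂₁, v₂^{±2}, û²]{v₂û, û²}.) -/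
noncomputable section

open LaurentPolynomial

/-- The ring `R = ℤ_(2)[v₁, v₂, v₂⁻¹, u]`, modeled as Laurent polynomials in `v₂`
over polynomials in the two variables `v₁` and `u`. -/
abbrev CPinftyPage : Type := LaurentPolynomial (MvPolynomial (Fin 2) ZTwoLocal)

/-- The element `v₁`. -/
def v₁P : CPinftyPage := LaurentPolynomial.C (MvPolynomial.X 0)

/-- The element `u`. -/
def uP : CPinftyPage := LaurentPolynomial.C (MvPolynomial.X 1)

/-- The element `v₂ⁿ` for `n : ℤ`. -/
def v₂P (n : ℤ) : CPinftyPage := T n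

/-- The monomial basis `(v₁v₂⁻³)^a (v₂²)^b (u²)^c · g`, where `g` runs through the
two generators `v₂u` and `u²`: these represent an `𝔽₂`-basis of the
`d_{1,1}`-homology, exhibiting it as a free `𝔽₂[s,t,t⁻¹,P]`-module on the classes
of `v₂u` and `u²`, where `s, t, P` act as the classes of `v₁v₂⁻³, v₂², u²`. -/
def monoCP : (ℕ × ℤ × ℕ) × Fin 2 → CPinftyPage := fun x =>
  v₁P ^ x.1.1 * v₂P (2 * x.1.2.1 - 3 * (x.1.1 : ℤ)) * uP ^ (2 * x.1.2.2) *
    (if x.2 = 0 then v₂P 1 * uP else uP ^ 2)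

namespace CPinftyPage

set_option synthInstance.maxHeartbeats 200000

/-- The monomial `v₁ᵃ v₂ⁿ uᵏ`. -/
def mon (a : ℕ) (n : ℤ) (k : ℕ) : CPinftyPage := v₁P ^ a * v₂P n * uP ^ k

/-- The inclusion of the constants `ℤ_(2)`. -/
def const : ZTwoLocal →+* CPinftyPage := LaurentPolynomial.C.comp MvPolynomial.C

theorem v₂P_mul (m n : ℤ) : v₂P m * v₂P n = v₂P (m + n) := (T_add m n).symm

theorem v₂P_zero : v₂P 0 = 1 := T_zero

theorem monoCP_zero (a : ℕ) (b : ℤ) (e : ℕ) :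
    monoCP ((a, b, e), 0) = mon a (2 * b - 3 * a + 1) (2 * e + 1) := by
  simp only [monoCP, mon, ← v₂P_mul, if_true]
  ring

theorem monoCP_one (a : ℕ) (b : ℤ) (e : ℕ) :
    monoCP ((a, b, e), 1) = mon a (2 * b - 3 * a) (2 * e + 2) := by
  simp only [monoCP, mon, one_ne_zero, if_false]
  ring

theorem mon_eq_C_mul_T (a : ℕ) (n : ℤ) (k : ℕ) :
    mon a n k = LaurentPolynomial.C (MvPolynomial.X 0 ^ a * MvPolynomial.X 1 ^ k) * T n := by
  simp only [mon, v₁P, v₂P, uP, map_mul, map_pow]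
  ring

theorem C_monomial_mul_T (m : Fin 2 →₀ ℕ) (r : ZTwoLocal) (n : ℤ) :
    LaurentPolynomial.C (MvPolynomial.monomial m r) * T n = const r * mon (m 0) n (m 1) := by
  rw [mon_eq_C_mul_T, MvPolynomial.monomial_eq, Finsupp.prod_fintype _ _ (by simp),
    Fin.prod_univ_two]
  simp only [const, RingHom.comp_apply, map_mul]
  ring

/-- The exponents of `v₁`, `v₂` and `u` in `monoCP x`. -/
def expo (x : (ℕ × ℤ × ℕ) × Fin 2) : ℕ × ℤ × ℕ :=
  (x.1.1, 2 * x.1.2.1 - 3 * x.1.1 + (1 - (x.2 : ℕ)), 2 * x.1.2.2 + 1 + (x.2 : ℕ))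

theorem monoCP_eq_mon (x : (ℕ × ℤ × ℕ) × Fin 2) :
    monoCP x = mon (expo x).1 (expo x).2.1 (expo x).2.2 := by
  obtain ⟨⟨a, b, e⟩, i⟩ := x
  fin_cases i
  · simpa [expo] using monoCP_zero a b e
  · simpa [expo] using monoCP_one a b e

theorem expo_injective : Function.Injective expo := by
  rintro ⟨⟨a, b, e⟩, i⟩ ⟨⟨a', b', e'⟩, j⟩ h
  simp only [expo, Prod.mk.injEq] at h
  obtain ⟨rfl, h₂, h₃⟩ := h
  have hi := i.isLt
  have hj := j.isLt
  have hij : i = j := Fin.ext (by omega)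
  subst hij
  simp only [Prod.mk.injEq, and_true, true_and]
  omega

theorem exists_monoCP_eq_mon {a : ℕ} {n : ℤ} {k : ℕ} (h : Even (a + n + (k + 1 : ℕ))) :
    ∃ x, monoCP x = mon a n (k + 1) := by
  obtain ⟨t, ht⟩ := h
  obtain ⟨e, rfl | rfl⟩ := Nat.even_or_odd' k
  · refine ⟨((a, (n + 3 * a - 1) / 2, e), 0), ?_⟩
    rw [monoCP_zero]
    congr 1
    push_cast at ht
    omega
  · refine ⟨((a, (n + 3 * a) / 2, e), 1), ?_⟩
    rw [monoCP_one]
    congr 1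
    push_cast at ht
    omega

theorem uP_mul_mon (a : ℕ) (n : ℤ) (k : ℕ) : uP * mon a n k = mon a n (k + 1) := by
  rw [mon, mon]; ring

theorem mon_succ_mem (a : ℕ) (n : ℤ) (k : ℕ) : mon a n (k + 1) ∈ Ideal.span {uP} := by
  rw [← uP_mul_mon]
  exact Ideal.mul_mem_right _ _ (Ideal.mem_span_singleton_self _)

theorem monoCP_mem (x : (ℕ × ℤ × ℕ) × Fin 2) : monoCP x ∈ Ideal.span {uP} := by
  rw [monoCP_eq_mon, show (expo x).2.2 = 2 * x.1.2.2 + (x.2 : ℕ) + 1 by simp only [expo]; ring]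
  exact mon_succ_mem _ _ _

theorem even_expo (x : (ℕ × ℤ × ℕ) × Fin 2) :
    Even ((expo x).1 + (expo x).2.1 + (expo x).2.2 : ℤ) :=
  ⟨x.1.2.1 - x.1.1 + x.1.2.2 + 1, by simp only [expo]; push_cast; ring⟩

/-- The coefficient of `v₁ᵃ v₂ⁿ uᵏ`, where `p = (a, n, k)`. -/
def coef (p : ℕ × ℤ × ℕ) : CPinftyPage →+ ZTwoLocal where
  toFun y := MvPolynomial.coeff (Finsupp.single 0 p.1 + Finsupp.single 1 p.2.2) (y.coeff p.2.1)
  map_zero' := by simp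
  map_add' := by simp

theorem coef_mon (p q : ℕ × ℤ × ℕ) :
    coef p (mon q.1 q.2.1 q.2.2) = if q = p then 1 else 0 := by
  obtain ⟨a, n, k⟩ := p
  obtain ⟨a', n', k'⟩ := q
  have hX : (MvPolynomial.X 0 ^ a' * MvPolynomial.X 1 ^ k' : MvPolynomial (Fin 2) ZTwoLocal) =
      MvPolynomial.monomial (Finsupp.single 0 a' + Finsupp.single 1 k') 1 := by
    simp [MvPolynomial.X_pow_eq_monomial, MvPolynomial.monomial_mul]
  have hexp : (Finsupp.single 0 a' + Finsupp.single 1 k' : Fin 2 →₀ ℕ) =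
      Finsupp.single 0 a + Finsupp.single 1 k ↔ a' = a ∧ k' = k := by
    simp [DFunLike.ext_iff, Fin.forall_fin_two]
  rw [mon_eq_C_mul_T, hX, ← single_eq_C_mul_T]
  change MvPolynomial.coeff (Finsupp.single 0 a + Finsupp.single 1 k)
    (Finsupp.single n' (MvPolynomial.monomial _ 1) n) = _
  rw [Finsupp.single_apply]
  by_cases hn : n' = n
  · simp [hn, MvPolynomial.coeff_monomial, hexp]
  · simp [hn]

theorem exists_eq_two_mul_or (r : ZTwoLocal) : ∃ t, r = 2 * t ∨ r = 1 + 2 * t := by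
  obtain ⟨a, s, rfl⟩ := IsLocalization.exists_mk'_eq (Ideal.span {(2 : ℤ)}).primeCompl r
  have hs : Odd (s : ℤ) := by
    rw [← Int.not_even_iff_odd, even_iff_two_dvd, ← Ideal.mem_span_singleton]
    exact s.2
  have key (b : ℤ) : IsLocalization.mk' ZTwoLocal (2 * b) s =
      2 * IsLocalization.mk' ZTwoLocal b s := by
    rw [← IsLocalization.mul_mk'_eq_mk'_of_mul, map_ofNat]
  obtain ⟨b, rfl | rfl⟩ := Int.even_or_odd' a
  · exact ⟨_, .inl (key b)⟩
  · obtain ⟨e, he⟩ := hs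
    refine ⟨IsLocalization.mk' ZTwoLocal (b - e) s, .inr ?_⟩
    rw [← key, eq_comm, add_comm (1 : ZTwoLocal),
      IsLocalization.mk'_add_eq_iff_add_mul_eq_mul, IsLocalization.mk'_spec, one_mul, ← map_add, he]
    congr 1
    ring

theorem not_two_dvd_one : ¬ (2 : ZTwoLocal) ∣ 1 := by
  rw [← isUnit_iff_dvd_one, ← map_ofNat (algebraMap ℤ ZTwoLocal) 2,
    IsLocalization.AtPrime.isUnit_to_map_iff ZTwoLocal (Ideal.span {(2 : ℤ)})]
  exact fun h => h (Ideal.mem_span_singleton_self 2)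

theorem eq_zero_of_eq_neg {y : CPinftyPage} (h : y = -y) : y = 0 := by
  have : CharZero ZTwoLocal :=
    charZero_of_injective_algebraMap (R := ℤ) (IsLocalization.injective _
      (Ideal.span {(2 : ℤ)}).primeCompl_le_nonZeroDivisors)
  ext n m
  have := congrArg (fun y : CPinftyPage => MvPolynomial.coeff m (y.coeff n)) h
  simpa [self_eq_neg] using this

theorem eq_empty_of_sum_monoCP_eq {S : Finset ((ℕ × ℤ × ℕ) × Fin 2)} {w : CPinftyPage}
    (h : ∑ s ∈ S, monoCP s = 2 * w) : S = ∅ := by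
  classical
  refine Finset.eq_empty_of_forall_notMem fun x hx => not_two_dvd_one ⟨coef (expo x) w, ?_⟩
  have := congrArg (coef (expo x)) h
  rw [two_mul, map_add, ← two_mul, map_sum] at this
  rw [← this]
  simp only [monoCP_eq_mon, coef_mon, expo_injective.eq_iff]
  simp [hx]

section Conjugation

variable {c : CPinftyPage →+* CPinftyPage}

theorem map_const (r : ZTwoLocal) : c (const r) = const r := by
  have : c.comp const = const :=
    IsLocalization.ringHom_ext (Ideal.span {(2 : ℤ)}).primeCompl (RingHom.ext_int _ _)
  exact DFunLike.congr_fun this r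

theorem map_v₂P_even (hcv₂ : c (v₂P 1) = -v₂P 1) (k : ℤ) : c (v₂P (2 * k)) = v₂P (2 * k) := by
  have h₂ : c (v₂P 2) = v₂P 2 := by
    rw [show v₂P 2 = v₂P 1 * v₂P 1 from (v₂P_mul 1 1).symm, map_mul, hcv₂]; ring
  have h₂' : c (v₂P (-2)) = v₂P (-2) := by
    have h : c (v₂P (-2)) * v₂P 2 = 1 := by
      rw [← h₂, ← map_mul, v₂P_mul]; simp [v₂P_zero]
    calc c (v₂P (-2)) = c (v₂P (-2)) * (v₂P 2 * v₂P (-2)) := by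
          rw [v₂P_mul]; simp [v₂P_zero]
      _ = v₂P (-2) := by rw [← mul_assoc, h, one_mul]
  induction k using Int.induction_on with
  | zero => simp [v₂P_zero]
  | succ i ih => rw [mul_add, mul_one, ← v₂P_mul, map_mul, ih, h₂]
  | pred i ih => rw [mul_sub, mul_one, sub_eq_add_neg, ← v₂P_mul, map_mul, ih, h₂']

theorem map_v₂P (hcv₂ : c (v₂P 1) = -v₂P 1) (n : ℤ) :
    c (v₂P n) = ((n.negOnePow : ℤ) : CPinftyPage) * v₂P n := by
  obtain ⟨k, rfl | rfl⟩ := Int.even_or_odd' n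
  · rw [map_v₂P_even hcv₂, Int.negOnePow_even _ (even_two_mul k)]; simp
  · rw [← v₂P_mul, map_mul, map_v₂P_even hcv₂, hcv₂, Int.negOnePow_odd _ ⟨k, rfl⟩]
    push_cast; ring

theorem neg_pow_eq_negOnePow_mul {R : Type*} [CommRing R] (x : R) (a : ℕ) :
    (-x) ^ a = (((a : ℤ).negOnePow : ℤ) : R) * x ^ a := by
  rw [Int.cast_negOnePow_natCast, neg_pow]

theorem map_mon (hcv₁ : c v₁P = -v₁P) (hcv₂ : c (v₂P 1) = -v₂P 1) (hcu : c uP = -uP)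
    (a : ℕ) (n : ℤ) (k : ℕ) :
    c (mon a n k) = (((a + n + k : ℤ).negOnePow : ℤ) : CPinftyPage) * mon a n k := by
  rw [mon, map_mul, map_mul, map_pow, map_pow, hcv₁, hcu, map_v₂P hcv₂,
    neg_pow_eq_negOnePow_mul v₁P, neg_pow_eq_negOnePow_mul uP]
  simp only [Int.negOnePow_add, Units.val_mul, Int.cast_mul]
  ring

theorem map_monoCP (hcv₁ : c v₁P = -v₁P) (hcv₂ : c (v₂P 1) = -v₂P 1) (hcu : c uP = -uP)
    (x : (ℕ × ℤ × ℕ) × Fin 2) : c (monoCP x) = monoCP x := by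
  rw [monoCP_eq_mon, map_mon hcv₁ hcv₂ hcu, Int.negOnePow_even _ (even_expo x)]
  simp

/-- `y` is a sum of distinct `monoCP x`, twice a fixed element of `(u)` and an anti-fixed
element. -/
def Decomposable (c : CPinftyPage →+* CPinftyPage) (y : CPinftyPage) : Prop :=
  ∃ S : Finset ((ℕ × ℤ × ℕ) × Fin 2), ∃ w ∈ Ideal.span {uP}, ∃ q, c w = w ∧ c q = -q ∧
    y = ∑ s ∈ S, monoCP s + 2 * w + q

theorem Decomposable.add (hcv₁ : c v₁P = -v₁P) (hcv₂ : c (v₂P 1) = -v₂P 1)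
    (hcu : c uP = -uP) {y y' : CPinftyPage} (h : Decomposable c y) (h' : Decomposable c y') :
    Decomposable c (y + y') := by
  classical
  obtain ⟨S, w, hwI, q, hw, hq, rfl⟩ := h
  obtain ⟨S', w', hwI', q', hw', hq', rfl⟩ := h'
  refine ⟨(S ∪ S') \ (S ∩ S'), ∑ s ∈ S ∩ S', monoCP s + w + w',
    add_mem (add_mem (sum_mem fun s _ => monoCP_mem s) hwI) hwI', q + q', ?_, ?_, ?_⟩
  · simp only [map_add, map_sum, map_monoCP hcv₁ hcv₂ hcu, hw, hw']
  · rw [map_add, hq, hq']; ring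
  · have h₁ := Finset.sum_sdiff (f := monoCP)
      (Finset.inter_subset_left.trans Finset.subset_union_left : S ∩ S' ⊆ S ∪ S')
    have h₂ := Finset.sum_union_inter (f := monoCP) (s₁ := S) (s₂ := S')
    linear_combination -h₁ - h₂

theorem decomposable_const_mul_mon (hcv₁ : c v₁P = -v₁P) (hcv₂ : c (v₂P 1) = -v₂P 1)
    (hcu : c uP = -uP) (r : ZTwoLocal) (a : ℕ) (n : ℤ) (k : ℕ) :
    Decomposable c (const r * mon a n (k + 1)) := by
  have hc := map_mon hcv₁ hcv₂ hcu a n (k + 1)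
  rcases Int.even_or_odd (a + n + (k + 1 : ℕ)) with h | h
  · rw [Int.negOnePow_even _ h, Units.val_one, Int.cast_one, one_mul] at hc
    obtain ⟨x, hx⟩ := exists_monoCP_eq_mon h
    obtain ⟨t, rfl | rfl⟩ := exists_eq_two_mul_or r
    · refine ⟨∅, const t * mon a n (k + 1), Ideal.mul_mem_left _ _ (mon_succ_mem _ _ _), 0,
        ?_, by rw [map_zero]; ring, ?_⟩
      · rw [map_mul, map_const, hc]
      · rw [map_mul, map_ofNat, Finset.sum_empty]; ring
    · refine ⟨{x}, const t * mon a n (k + 1), Ideal.mul_mem_left _ _ (mon_succ_mem _ _ _), 0,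
        ?_, by rw [map_zero]; ring, ?_⟩
      · rw [map_mul, map_const, hc]
      · rw [map_add, map_mul, map_one, map_ofNat, Finset.sum_singleton, hx]; ring
  · rw [Int.negOnePow_odd _ h] at hc
    refine ⟨∅, 0, zero_mem _, const r * mon a n (k + 1), map_zero c, ?_, by simp⟩
    rw [map_mul, map_const, hc]
    push_cast
    ring

theorem decomposable_of_mem (hcv₁ : c v₁P = -v₁P) (hcv₂ : c (v₂P 1) = -v₂P 1)
    (hcu : c uP = -uP) {y : CPinftyPage} (hy : y ∈ Ideal.span {uP}) : Decomposable c y := by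
  obtain ⟨y, rfl⟩ := Ideal.mem_span_singleton.mp hy
  clear hy
  induction y using LaurentPolynomial.induction_on' with
  | add p q hp hq => rw [mul_add]; exact hp.add hcv₁ hcv₂ hcu hq
  | C_mul_T n p =>
    induction p using MvPolynomial.induction_on' with
    | add p q hp hq => rw [map_add, add_mul, mul_add]; exact hp.add hcv₁ hcv₂ hcu hq
    | monomial m r =>
      rw [C_monomial_mul_T, mul_left_comm, uP_mul_mon]
      exact decomposable_const_mul_mon hcv₁ hcv₂ hcu _ _ _ _

end Conjugation

end CPinftyPage

set_option synthInstance.maxHeartbeats 1000000 in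
set_option maxHeartbeats 2000000 in
/-- Let `R = ℤ_(2)[v₁, v₂, v₂⁻¹, u]`, let `c` be the ring
involution with `c(v₁) = −v₁`, `c(v₂) = −v₂`, `c(u) = −u`, let
`d(y) = v₂⁻³·(y − c(y))`, and let `I = (u)`.  Then `d(I) ⊆ I`, `d∘d = 0` on `I`,
and the homology `ker(d|_I)/im(d|_I)` is a free module over `𝔽₂[s,t,t⁻¹,P]` on
the classes of `v₂u` and `u²` (with `s, t, P` acting as the classes of
`v₁v₂⁻³`, `v₂²`, `u²`): the classes of the elements `monoCP x` form an
`𝔽₂`-basis of the homology. -/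
theorem bockstein_d11_CPinfty
    (c : CPinftyPage →+* CPinftyPage) (hinv : ∀ y, c (c y) = y)
    (hcv₁ : c v₁P = -v₁P) (hcv₂ : c (v₂P 1) = -v₂P 1) (hcu : c uP = -uP) :
    let d : CPinftyPage → CPinftyPage := fun y => v₂P (-3) * (y - c y)
    let I : Ideal CPinftyPage := Ideal.span {uP}
    (∀ y ∈ I, d y ∈ I) ∧
    (∀ y ∈ I, d (d y) = 0) ∧
    (∀ x, monoCP x ∈ I ∧ d (monoCP x) = 0) ∧
    (∀ y ∈ I, d y = 0 →
      ∃ S : Finset ((ℕ × ℤ × ℕ) × Fin 2), ∃ z ∈ I, y - ∑ s ∈ S, monoCP s = d z) ∧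
    (∀ y ∈ I, d y = 0 → ∃ z ∈ I, 2 * y = d z) ∧
    (∀ S : Finset ((ℕ × ℤ × ℕ) × Fin 2),
      (∃ z ∈ I, ∑ s ∈ S, monoCP s = d z) → S = ∅) := by
  intro d I
  have hc3 : c (v₂P (-3)) = -v₂P (-3) := by
    rw [CPinftyPage.map_v₂P hcv₂, Int.negOnePow_odd _ ⟨-2, by norm_num⟩]
    push_cast; ring
  have hc3' : c (v₂P 3) = -v₂P 3 := by
    rw [CPinftyPage.map_v₂P hcv₂, Int.negOnePow_odd _ ⟨1, by norm_num⟩]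
    push_cast; ring
  have h33 : v₂P (-3) * v₂P 3 = 1 := by
    rw [CPinftyPage.v₂P_mul]; simp [CPinftyPage.v₂P_zero]
  have hcI : ∀ y ∈ I, c y ∈ I := by
    intro y hy
    obtain ⟨t, rfl⟩ := Ideal.mem_span_singleton.mp hy
    rw [map_mul, hcu, show -uP * c t = uP * -c t by ring]
    exact Ideal.mul_mem_right _ _ (Ideal.mem_span_singleton_self _)
  have fixed_of_d : ∀ y, d y = 0 → c y = y := by
    intro y hy
    have hy : v₂P (-3) * (y - c y) = 0 := hy
    linear_combination -v₂P 3 * hy + (y - c y) * h33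
  have two_mul_fixed : ∀ w ∈ I, c w = w → ∃ z ∈ I, 2 * w = d z := by
    intro w hw hcw
    refine ⟨v₂P 3 * w, Ideal.mul_mem_left _ _ hw, ?_⟩
    change 2 * w = v₂P (-3) * (v₂P 3 * w - c (v₂P 3 * w))
    rw [map_mul, hc3', hcw]
    linear_combination -2 * w * h33
  have hmono := CPinftyPage.map_monoCP hcv₁ hcv₂ hcu
  refine ⟨?_, ?_, ?_, ?_, ?_, ?_⟩
  · intro y hy
    change v₂P (-3) * (y - c y) ∈ I
    rw [show y - c y = y + -1 * c y by ring]
    exact I.mul_mem_left _ (I.add_mem hy (I.mul_mem_left _ (hcI y hy)))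
  · intro y _
    change v₂P (-3) * (v₂P (-3) * (y - c y) - c (v₂P (-3) * (y - c y))) = 0
    rw [map_mul, map_sub, hinv, hc3]
    ring
  · refine fun x => ⟨CPinftyPage.monoCP_mem x, ?_⟩
    change v₂P (-3) * (monoCP x - c (monoCP x)) = 0
    rw [hmono, sub_self, mul_zero]
  · intro y hy hdy
    have hcy := fixed_of_d y hdy
    obtain ⟨S, w, hwI, q, hw, hq, rfl⟩ := CPinftyPage.decomposable_of_mem hcv₁ hcv₂ hcu hy
    have hq0 : q = 0 := by
      apply CPinftyPage.eq_zero_of_eq_neg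
      simp only [map_add, map_sum, hmono, map_mul, hw, hq, map_ofNat] at hcy
      exact (add_left_cancel hcy).symm
    obtain ⟨z, hz, h⟩ := two_mul_fixed w hwI hw
    refine ⟨S, z, hz, ?_⟩
    rw [← h, hq0]
    ring
  · exact fun y hy hdy => two_mul_fixed y hy (fixed_of_d y hdy)
  · rintro S ⟨z, hz, h⟩
    obtain ⟨S', w, -, q, hw, hq, rfl⟩ := CPinftyPage.decomposable_of_mem hcv₁ hcv₂ hcu hz
    refine CPinftyPage.eq_empty_of_sum_monoCP_eq (w := v₂P (-3) * q) (h.trans ?_)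
    change v₂P (-3) * (_ - c _) = _
    simp only [map_add, map_sum, hmono, map_mul, hw, hq, map_ofNat]
    ring
end
end
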